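/- arXiv:2101.02592 — 13 statements merged into one kernel-verified Lean document; each statement's English description precedes it below -/
import Mathlib

section
/- Let A₁A₂A₃A₄ be an isosceles tetrahedron in ℝ³ (meaning d(A₂,A₃) = d(A₁,A₄), d(A₃,A₁) = d(A₂,A₄), and d(A₁,A₂) = d(A₃,A₄)). Let x₁, x₂, x₃ be real numbers with x₁ + x₂ + x₃ = 1, and define the points P₁ = x₃A₂ + x₂A₃ + x₁A₄, P₂ = x₃A₁ + x₁A₃ + x₂A₄, P₃ = x₂A₁ + x₁A₂ + x₃A₄, P₄ = x₁A₁ + x₂A₂ + x₃A₃ (so Pᵢ is the point with the same areal coordinates on face i, assigned according to the four-fold symmetry of the isosceles tetrahedron). Then the four cevians have equal length: d(A₁,P₁) = d(A₂,P₂) = d(A₃,P₃) = d(A₄,P₄). -/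
/-- Squared distance from a point to an affine combination of three points. -/
theorem dist_sq_affine_comb (Q A B C : EuclideanSpace ℝ (Fin 3)) (x y z : ℝ)
    (h : x + y + z = 1) :
    dist Q (x • A + y • B + z • C) ^ 2 =
      x * dist Q A ^ 2 + y * dist Q B ^ 2 + z * dist Q C ^ 2
        - (x * y * dist A B ^ 2 + y * z * dist B C ^ 2 + x * z * dist A C ^ 2) := by
  obtain rfl : z = 1 - x - y := by linarith
  simp only [EuclideanSpace.dist_sq_eq, Real.dist_eq, sq_abs, Fin.sum_univ_three,
    PiLp.add_apply, PiLp.smul_apply, smul_eq_mul]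
  ring

/-- In an isosceles tetrahedron, the cevians to corresponding face centers (points with the
same areal coordinates on each face, assigned according to the four-fold symmetry) all have
the same length. -/
theorem isosceles_tetrahedron_cevians_equal_length
    (A1 A2 A3 A4 : EuclideanSpace ℝ (Fin 3))
    (hind : AffineIndependent ℝ ![A1, A2, A3, A4])
    (h1 : dist A2 A3 = dist A1 A4)
    (h2 : dist A3 A1 = dist A2 A4)
    (h3 : dist A1 A2 = dist A3 A4)
    (x1 x2 x3 : ℝ) (hx : x1 + x2 + x3 = 1)
    (P1 P2 P3 P4 : EuclideanSpace ℝ (Fin 3))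
    (hP1 : P1 = x3 • A2 + x2 • A3 + x1 • A4)
    (hP2 : P2 = x3 • A1 + x1 • A3 + x2 • A4)
    (hP3 : P3 = x2 • A1 + x1 • A2 + x3 • A4)
    (hP4 : P4 = x1 • A1 + x2 • A2 + x3 • A3) :
    dist A1 P1 = dist A2 P2 ∧ dist A2 P2 = dist A3 P3 ∧ dist A3 P3 = dist A4 P4 := by
  subst hP1 hP2 hP3 hP4
  have e1 := dist_sq_affine_comb A1 A2 A3 A4 x3 x2 x1 (by linarith)
  have e2 := dist_sq_affine_comb A2 A1 A3 A4 x3 x1 x2 (by linarith)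
  have e3 := dist_sq_affine_comb A3 A1 A2 A4 x2 x1 x3 (by linarith)
  have e4 := dist_sq_affine_comb A4 A1 A2 A3 x1 x2 x3 (by linarith)
  simp only [dist_comm A2 A1, dist_comm A3 A1, dist_comm A3 A2, dist_comm A4 A1,
    dist_comm A4 A2, dist_comm A4 A3] at h1 h2 h3 e1 e2 e3 e4
  rw [h1, h2, h3] at e1 e2 e3 e4
  refine ⟨?_, ?_, ?_⟩ <;> rw [← sq_eq_sq₀ dist_nonneg dist_nonneg]
  · rw [e1, e2]; ring
  · rw [e2, e3]; ring
  · rw [e3, e4]; ring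
end

section
/- Let A₁A₂A₃A₄ be an isosceles tetrahedron in ℝ³ (meaning d(A₂,A₃) = d(A₁,A₄), d(A₃,A₁) = d(A₂,A₄), and d(A₁,A₂) = d(A₃,A₄)). Let x₁, x₂, x₃ be real numbers with x₁ + x₂ + x₃ = 1, and define P₁ = x₃A₂ + x₂A₃ + x₁A₄, P₂ = x₃A₁ + x₁A₃ + x₂A₄, P₃ = x₂A₁ + x₁A₂ + x₃A₄, P₄ = x₁A₁ + x₂A₂ + x₃A₃. Then the central tetrahedron P₁P₂P₃P₄ is isosceles: d(P₁,P₂) = d(P₃,P₄), d(P₁,P₃) = d(P₂,P₄), and d(P₁,P₄) = d(P₂,P₃). -/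
theorem norm_swap_aux (u v : EuclideanSpace ℝ (Fin 3)) (h : ‖u‖ = ‖v‖) (a b : ℝ) :
    ‖a • u + b • v‖ = ‖b • u + a • v‖ := by
  have key : ‖a • u + b • v‖ ^ 2 = ‖b • u + a • v‖ ^ 2 := by
    rw [norm_add_sq_real, norm_add_sq_real]
    simp only [norm_smul, mul_pow, inner_smul_left, inner_smul_right, h, Real.norm_eq_abs, sq_abs,
      conj_trivial]
    ring
  exact (sq_eq_sq₀ (norm_nonneg _) (norm_nonneg _)).1 key

theorem dist_swap_aux (u v p q r s : EuclideanSpace ℝ (Fin 3)) (h : ‖u‖ = ‖v‖) (a b : ℝ)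
    (h1 : p - q = a • u + b • v) (h2 : r - s = -(b • u + a • v)) : dist p q = dist r s := by
  rw [dist_eq_norm, dist_eq_norm, h1, h2, norm_neg, norm_swap_aux u v h]

/-- In an isosceles tetrahedron, the central tetrahedron formed by corresponding face centers
(points with the same areal coordinates on each face, assigned according to the four-fold
symmetry) is itself isosceles: its opposite edges have equal length. -/
theorem isosceles_tetrahedron_central_tetrahedron_isosceles
    (A1 A2 A3 A4 : EuclideanSpace ℝ (Fin 3))
    (hind : AffineIndependent ℝ ![A1, A2, A3, A4])
    (h1 : dist A2 A3 = dist A1 A4)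
    (h2 : dist A3 A1 = dist A2 A4)
    (h3 : dist A1 A2 = dist A3 A4)
    (x1 x2 x3 : ℝ) (hx : x1 + x2 + x3 = 1)
    (P1 P2 P3 P4 : EuclideanSpace ℝ (Fin 3))
    (hP1 : P1 = x3 • A2 + x2 • A3 + x1 • A4)
    (hP2 : P2 = x3 • A1 + x1 • A3 + x2 • A4)
    (hP3 : P3 = x2 • A1 + x1 • A2 + x3 • A4)
    (hP4 : P4 = x1 • A1 + x2 • A2 + x3 • A3) :
    dist P1 P2 = dist P3 P4 ∧ dist P1 P3 = dist P2 P4 ∧ dist P1 P4 = dist P2 P3 := by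
  subst hP1 hP2 hP3 hP4
  refine ⟨dist_swap_aux (A2 - A1) (A3 - A4) _ _ _ _ ?_ x3 (x2 - x1) (by module) (by module),
    dist_swap_aux (A2 - A4) (A3 - A1) _ _ _ _ ?_ (x3 - x1) x2 (by module) (by module),
    dist_swap_aux (A2 - A3) (A4 - A1) _ _ _ _ ?_ (x3 - x2) x1 (by module) (by module)⟩
  · rw [← dist_eq_norm, ← dist_eq_norm, dist_comm, h3]
  · rw [← dist_eq_norm, ← dist_eq_norm, h2]
  · rw [← dist_eq_norm, ← dist_eq_norm, h1, dist_comm]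
end

section
/- Let A₁A₂A₃A₄ be a circumscriptible tetrahedron in ℝ³, i.e. d(A₂,A₃)+d(A₁,A₄) = d(A₃,A₁)+d(A₂,A₄) = d(A₁,A₂)+d(A₃,A₄). For each i, let Γᵢ be the Gergonne point of the face opposite Aᵢ. Then the four cevians joining Aᵢ to Γᵢ (i = 1,2,3,4) are concurrent: there is a point Q lying on all four lines. -/
/-- The Gergonne point of a triangle `XYZ`: the normalized barycentric combination with
weight `1/(d(V,U) + d(V,W) - d(U,W))` at each vertex `V`. -/
noncomputable def gergonnePoint (X Y Z : EuclideanSpace ℝ (Fin 3)) : EuclideanSpace ℝ (Fin 3) :=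
  let uX := 1 / (dist X Y + dist X Z - dist Y Z)
  let uY := 1 / (dist Y X + dist Y Z - dist X Z)
  let uZ := 1 / (dist Z X + dist Z Y - dist X Y)
  (1 / (uX + uY + uZ)) • (uX • X + uY • Y + uZ • Z)

/-- Strict triangle inequality for three affinely independent points. -/
lemma strict_tri (P : Fin 4 → EuclideanSpace ℝ (Fin 3)) (hP : AffineIndependent ℝ P)
    (i j k : Fin 4) (hij : i ≠ j) (hik : i ≠ k) (hjk : j ≠ k) :
    0 < dist (P i) (P j) + dist (P i) (P k) - dist (P j) (P k) := by
  have h1 : AffineIndependent ℝ ![P i, P j, P k] := by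
    have hinj : Function.Injective ![i, j, k] := by
      intro a b
      fin_cases a <;> fin_cases b <;> simp [hij, hik, hjk, hij.symm, hik.symm, hjk.symm]
    have h2 := hP.comp_embedding ⟨![i, j, k], hinj⟩
    convert h2 using 1
    ext a : 1
    fin_cases a <;> rfl
  have h3 := affineIndependent_iff_not_collinear_set.1 h1
  have h4 := dist_triangle (P j) (P i) (P k)
  rw [dist_comm (P j) (P i)] at h4
  rcases h4.lt_or_eq with h | h
  · linarith
  · exfalso
    apply h3
    have : Wbtw ℝ (P j) (P i) (P k) := by
      rw [← dist_add_dist_eq_iff, dist_comm (P j) (P i)]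
      exact h.symm
    have h5 := this.collinear
    rwa [Set.insert_comm] at h5

lemma gergonne_eq (X Y Z : EuclideanSpace ℝ (Fin 3)) (x y z : ℝ)
    (hx : dist X Y + dist X Z - dist Y Z = x)
    (hy : dist Y X + dist Y Z - dist X Z = y)
    (hz : dist Z X + dist Z Y - dist X Y = z) :
    gergonnePoint X Y Z = (1 / (1 / x + 1 / y + 1 / z)) •
      ((1 / x) • X + (1 / y) • Y + (1 / z) • Z) := by
  simp only [gergonnePoint, hx, hy, hz]

lemma mem_cevian (A B C D : EuclideanSpace ℝ (Fin 3)) (p q r s : ℝ)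
    (hp : 0 < p) (hq : 0 < q) (hr : 0 < r) (hs : 0 < s) :
    (1 / (p + q + r + s)) • (p • A + q • B + r • C + s • D) ∈
      affineSpan ℝ ({A, (1 / (q + r + s)) • (q • B + r • C + s • D)} :
        Set (EuclideanSpace ℝ (Fin 3))) := by
  have h : (1 / (p + q + r + s)) • (p • A + q • B + r • C + s • D) =
      AffineMap.lineMap A ((1 / (q + r + s)) • (q • B + r • C + s • D))
        ((q + r + s) / (p + q + r + s)) := by
    have h1 : q + r + s ≠ 0 := by positivity
    have h2 : p + q + r + s ≠ 0 := by positivity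
    rw [AffineMap.lineMap_apply_module]
    ext i
    simp only [PiLp.add_apply, PiLp.smul_apply, smul_eq_mul]
    field_simp
    ring
  rw [h]
  exact AffineMap.lineMap_mem_affineSpan_pair _ _ _

/-- In a circumscriptible tetrahedron, the four cevians from each vertex to the Gergonne
point of the opposite face are concurrent. -/
theorem circumscriptible_cevians_to_gergonne_points_concur
    (A1 A2 A3 A4 : EuclideanSpace ℝ (Fin 3))
    (hind : AffineIndependent ℝ ![A1, A2, A3, A4])
    (hc1 : dist A2 A3 + dist A1 A4 = dist A3 A1 + dist A2 A4)
    (hc2 : dist A3 A1 + dist A2 A4 = dist A1 A2 + dist A3 A4) :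
    ∃ Q : EuclideanSpace ℝ (Fin 3),
      Q ∈ affineSpan ℝ ({A1, gergonnePoint A2 A3 A4} : Set (EuclideanSpace ℝ (Fin 3))) ∧
      Q ∈ affineSpan ℝ ({A2, gergonnePoint A1 A3 A4} : Set (EuclideanSpace ℝ (Fin 3))) ∧
      Q ∈ affineSpan ℝ ({A3, gergonnePoint A1 A2 A4} : Set (EuclideanSpace ℝ (Fin 3))) ∧
      Q ∈ affineSpan ℝ ({A4, gergonnePoint A1 A2 A3} : Set (EuclideanSpace ℝ (Fin 3))) := by
  have h1 := strict_tri _ hind 0 1 2 (by decide) (by decide) (by decide)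
  have h2 := strict_tri _ hind 1 0 2 (by decide) (by decide) (by decide)
  have h3 := strict_tri _ hind 2 0 1 (by decide) (by decide) (by decide)
  have h4 := strict_tri _ hind 3 0 1 (by decide) (by decide) (by decide)
  change 0 < dist A1 A2 + dist A1 A3 - dist A2 A3 at h1
  change 0 < dist A2 A1 + dist A2 A3 - dist A1 A3 at h2
  change 0 < dist A3 A1 + dist A3 A2 - dist A1 A2 at h3
  change 0 < dist A4 A1 + dist A4 A2 - dist A1 A2 at h4
  have c12 := dist_comm A1 A2
  have c13 := dist_comm A1 A3
  have c14 := dist_comm A1 A4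
  have c23 := dist_comm A2 A3
  have c24 := dist_comm A2 A4
  have c34 := dist_comm A3 A4
  obtain ⟨a, ha⟩ : ∃ a, a = dist A1 A2 + dist A1 A3 - dist A2 A3 := ⟨_, rfl⟩
  obtain ⟨b, hb⟩ : ∃ b, b = dist A2 A1 + dist A2 A3 - dist A1 A3 := ⟨_, rfl⟩
  obtain ⟨c, hc⟩ : ∃ c, c = dist A3 A1 + dist A3 A2 - dist A1 A2 := ⟨_, rfl⟩
  obtain ⟨d, hd⟩ : ∃ d, d = dist A4 A1 + dist A4 A2 - dist A1 A2 := ⟨_, rfl⟩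
  rw [← ha] at h1
  rw [← hb] at h2
  rw [← hc] at h3
  rw [← hd] at h4
  rw [gergonne_eq A2 A3 A4 b c d (by linarith) (by linarith) (by linarith),
    gergonne_eq A1 A3 A4 a c d (by linarith) (by linarith) (by linarith),
    gergonne_eq A1 A2 A4 a b d (by linarith) (by linarith) (by linarith),
    gergonne_eq A1 A2 A3 a b c (by linarith) (by linarith) (by linarith)]
  have k1 := one_div_pos.2 h1
  have k2 := one_div_pos.2 h2
  have k3 := one_div_pos.2 h3
  have k4 := one_div_pos.2 h4
  refine ⟨_, mem_cevian A1 A2 A3 A4 _ _ _ _ k1 k2 k3 k4, ?_, ?_, ?_⟩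
  · convert mem_cevian A2 A1 A3 A4 _ _ _ _ k2 k1 k3 k4 using 2
    · ring
    · abel
  · convert mem_cevian A3 A1 A2 A4 _ _ _ _ k3 k1 k2 k4 using 2
    · ring
    · abel
  · convert mem_cevian A4 A1 A2 A3 _ _ _ _ k4 k1 k2 k3 using 2
    · ring
    · abel
end

section
/- Let A₁A₂A₃A₄ be a circumscriptible tetrahedron in ℝ³, i.e. d(A₂,A₃)+d(A₁,A₄) = d(A₃,A₁)+d(A₂,A₄) = d(A₁,A₂)+d(A₃,A₄). For each i, let Nᵢ be the Nagel point of the face opposite Aᵢ. Then the four cevians joining Aᵢ to Nᵢ (i = 1,2,3,4) are concurrent: there is a point Q lying on all four lines. -/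
/-- The Nagel point of a triangle `XYZ`: the normalized barycentric combination with
weight `d(V,U) + d(V,W) - d(U,W)` at each vertex `V`. -/
noncomputable def nagelPoint (X Y Z : EuclideanSpace ℝ (Fin 3)) : EuclideanSpace ℝ (Fin 3) :=
  let uX := dist X Y + dist X Z - dist Y Z
  let uY := dist Y X + dist Y Z - dist X Z
  let uZ := dist Z X + dist Z Y - dist X Y
  (1 / (uX + uY + uZ)) • (uX • X + uY • Y + uZ • Z)

/-- If the edges of a triangle are sums of tangent lengths, the barycentric combination with those
tangent lengths lies on the cevian to the Nagel point. -/
lemma mem_cevian_nagel (P X Y Z Q : EuclideanSpace ℝ (Fin 3)) (p x y z : ℝ)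
    (hxy : dist X Y = x + y) (hxz : dist X Z = x + z) (hyz : dist Y Z = y + z)
    (h3 : x + y + z ≠ 0) (h4 : p + x + y + z ≠ 0)
    (hQ : Q = (1 / (p + x + y + z)) • (p • P + x • X + y • Y + z • Z)) :
    Q ∈ affineSpan ℝ ({P, nagelPoint X Y Z} : Set (EuclideanSpace ℝ (Fin 3))) := by
  have hN : nagelPoint X Y Z = (1 / (x + y + z)) • (x • X + y • Y + z • Z) := by
    have e1 : x + y + (x + z) - (y + z) = 2 * x := by ring
    have e2 : x + y + (y + z) - (x + z) = 2 * y := by ring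
    have e3 : x + z + (y + z) - (x + y) = 2 * z := by ring
    have e4 : 2 * x + 2 * y + 2 * z = 2 * (x + y + z) := by ring
    simp only [nagelPoint, dist_comm Y X, dist_comm Z X, dist_comm Z Y, hxy, hxz, hyz,
      e1, e2, e3, e4]
    match_scalars <;> field_simp
  have key : Q = AffineMap.lineMap P (nagelPoint X Y Z) ((x + y + z) / (p + x + y + z)) := by
    rw [hQ, hN, AffineMap.lineMap_apply_module]
    match_scalars <;> field_simp
    ring
  rw [key]
  exact AffineMap.lineMap_mem_affineSpan_pair _ _ _

/-- In a circumscriptible tetrahedron, the four cevians from each vertex to the Nagel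
point of the opposite face are concurrent. -/
theorem circumscriptible_cevians_to_nagel_points_concur
    (A1 A2 A3 A4 : EuclideanSpace ℝ (Fin 3))
    (hind : AffineIndependent ℝ ![A1, A2, A3, A4])
    (hc1 : dist A2 A3 + dist A1 A4 = dist A3 A1 + dist A2 A4)
    (hc2 : dist A3 A1 + dist A2 A4 = dist A1 A2 + dist A3 A4) :
    ∃ Q : EuclideanSpace ℝ (Fin 3),
      Q ∈ affineSpan ℝ ({A1, nagelPoint A2 A3 A4} : Set (EuclideanSpace ℝ (Fin 3))) ∧
      Q ∈ affineSpan ℝ ({A2, nagelPoint A1 A3 A4} : Set (EuclideanSpace ℝ (Fin 3))) ∧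
      Q ∈ affineSpan ℝ ({A3, nagelPoint A1 A2 A4} : Set (EuclideanSpace ℝ (Fin 3))) ∧
      Q ∈ affineSpan ℝ ({A4, nagelPoint A1 A2 A3} : Set (EuclideanSpace ℝ (Fin 3))) := by
  have hne : ∀ i j : Fin 4, i ≠ j → 0 < dist (![A1, A2, A3, A4] i) (![A1, A2, A3, A4] j) :=
    fun i j hij => dist_pos.2 (fun h => hij (hind.injective h))
  have h12 : 0 < dist A1 A2 := hne 0 1 (by decide)
  have h13 : 0 < dist A1 A3 := hne 0 2 (by decide)
  have h14 : 0 < dist A1 A4 := hne 0 3 (by decide)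
  have h23 : 0 < dist A2 A3 := hne 1 2 (by decide)
  have h24 : 0 < dist A2 A4 := hne 1 3 (by decide)
  have h34 : 0 < dist A3 A4 := hne 2 3 (by decide)
  rw [dist_comm A3 A1] at hc1 hc2
  obtain ⟨a, ha⟩ : ∃ a, a = (dist A1 A2 + dist A1 A3 - dist A2 A3) / 2 := ⟨_, rfl⟩
  obtain ⟨b, hb⟩ : ∃ b, b = dist A1 A2 - a := ⟨_, rfl⟩
  obtain ⟨c, hc⟩ : ∃ c, c = dist A1 A3 - a := ⟨_, rfl⟩
  obtain ⟨d, hd⟩ : ∃ d, d = dist A1 A4 - a := ⟨_, rfl⟩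
  have e12 : dist A1 A2 = a + b := by linarith
  have e13 : dist A1 A3 = a + c := by linarith
  have e14 : dist A1 A4 = a + d := by linarith
  have e23 : dist A2 A3 = b + c := by linarith
  have e24 : dist A2 A4 = b + d := by linarith
  have e34 : dist A3 A4 = c + d := by linarith
  have hs : a + b + c + d ≠ 0 := ne_of_gt (by linarith)
  refine ⟨(1 / (a + b + c + d)) • (a • A1 + b • A2 + c • A3 + d • A4), ?_, ?_, ?_, ?_⟩
  · exact mem_cevian_nagel _ _ _ _ _ a b c d e23 e24 e34 (ne_of_gt (by linarith)) hs rfl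
  · refine mem_cevian_nagel _ _ _ _ _ b a c d e13 e14 e34 (ne_of_gt (by linarith)) (ne_of_gt (by linarith)) ?_
    rw [show b + a + c + d = a + b + c + d by ring]; module
  · refine mem_cevian_nagel _ _ _ _ _ c a b d e12 e14 e24 (ne_of_gt (by linarith)) (ne_of_gt (by linarith)) ?_
    rw [show c + a + b + d = a + b + c + d by ring]; module
  · refine mem_cevian_nagel _ _ _ _ _ d a b c e12 e13 e23 (ne_of_gt (by linarith)) (ne_of_gt (by linarith)) ?_
    rw [show d + a + b + c = a + b + c + d by ring]; module
end

section
/- Let A₁A₂A₃A₄ be a circumscriptible tetrahedron in ℝ³, i.e. d(A₂,A₃)+d(A₁,A₄) = d(A₃,A₁)+d(A₂,A₄) = d(A₁,A₂)+d(A₃,A₄). For each i, let Iᵢ be the incenter of the face opposite Aᵢ. Then the four normals to the faces at the incenters are concurrent: there is a point Q such that for each i, Q − Iᵢ is orthogonal to the plane of face i. -/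
open scoped RealInnerProductSpace

/-- The incenter of a triangle `XYZ`: the normalized barycentric combination with weight
the length of the opposite side at each vertex. -/
noncomputable def incenterPoint (X Y Z : EuclideanSpace ℝ (Fin 3)) : EuclideanSpace ℝ (Fin 3) :=
  (1 / (dist Y Z + dist X Z + dist X Y)) •
    (dist Y Z • X + dist X Z • Y + dist X Y • Z)

lemma inner_half (X Y Z : EuclideanSpace ℝ (Fin 3)) :
    ⟪Y - X, Z - X⟫ = (dist X Y ^ 2 + dist X Z ^ 2 - dist Y Z ^ 2) / 2 := by
  have h := norm_sub_sq_real (Y - X) (Z - X)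
  rw [sub_sub_sub_cancel_right] at h
  rw [dist_comm X Y, dist_comm X Z, dist_eq_norm, dist_eq_norm, dist_eq_norm]
  linarith

lemma incenter_aux (X Y Z : EuclideanSpace ℝ (Fin 3)) (h : X ≠ Y) :
    ⟪incenterPoint X Y Z - X, Y - X⟫ = dist X Y * ((dist X Y + dist X Z - dist Y Z) / 2) ∧
    ⟪incenterPoint X Y Z - X, Z - X⟫ = dist X Z * ((dist X Y + dist X Z - dist Y Z) / 2) := by
  have hp : dist Y Z + dist X Z + dist X Y ≠ 0 := by
    have := dist_pos.2 h
    positivity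
  have e : incenterPoint X Y Z - X = (1 / (dist Y Z + dist X Z + dist X Y)) •
      (dist X Z • (Y - X) + dist X Y • (Z - X)) := by
    have : X = (1 / (dist Y Z + dist X Z + dist X Y)) •
        ((dist Y Z + dist X Z + dist X Y) • X) := by
      rw [smul_smul, one_div_mul_cancel hp, one_smul]
    unfold incenterPoint
    rw [sub_eq_iff_eq_add]
    refine Eq.trans ?_ (congrArg (_ + ·) this.symm)
    rw [← smul_add]
    congr 1
    module
  rw [e]
  have h1 := inner_half X Y Z
  have h2 := real_inner_comm (Y - X) (Z - X)
  have h3 : ⟪Y - X, Y - X⟫ = dist X Y ^ 2 := by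
    rw [real_inner_self_eq_norm_sq, dist_comm, dist_eq_norm]
  have h4 : ⟪Z - X, Z - X⟫ = dist X Z ^ 2 := by
    rw [real_inner_self_eq_norm_sq, dist_comm, dist_eq_norm]
  rw [h1] at h2
  simp only [inner_smul_left, inner_add_left, h1, h2, h3, h4]
  simp only [conj_trivial]
  constructor <;> field_simp <;> ring

lemma exists_inner (v : Fin 3 → EuclideanSpace ℝ (Fin 3)) (hv : LinearIndependent ℝ v)
    (c : Fin 3 → ℝ) : ∃ q : EuclideanSpace ℝ (Fin 3), ∀ i, ⟪q, v i⟫ = c i := by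
  let b := basisOfLinearIndependentOfCardEqFinrank hv (by simp)
  refine ⟨(InnerProductSpace.toDual ℝ _).symm (LinearMap.toContinuousLinearMap (b.constr ℝ c)), fun i => ?_⟩
  rw [InnerProductSpace.toDual_symm_apply]
  have : v i = b i := by simp [b]
  rw [this]
  simp

/-- The two conditions at a face, moved to the base vertex. -/
lemma face_aux (Q X Y Z : EuclideanSpace ℝ (Fin 3)) (h : X ≠ Y)
    (h1 : ⟪Q - X, Y - X⟫ = dist X Y * ((dist X Y + dist X Z - dist Y Z) / 2))
    (h2 : ⟪Q - X, Z - X⟫ = dist X Z * ((dist X Y + dist X Z - dist Y Z) / 2)) :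
    ⟪Q - incenterPoint X Y Z, Y - X⟫ = 0 ∧ ⟪Q - incenterPoint X Y Z, Z - X⟫ = 0 := by
  obtain ⟨k1, k2⟩ := incenter_aux X Y Z h
  rw [← sub_sub_sub_cancel_right Q _ X, inner_sub_left, inner_sub_left (Q - X) _ (Z - X),
    h1, h2, k1, k2]
  simp

lemma inner_move (Q X Y Z : EuclideanSpace ℝ (Fin 3)) :
    ⟪Q - Y, Z - Y⟫ = ⟪Q - X, Z - X⟫ - ⟪Q - X, Y - X⟫
      - (dist X Y ^ 2 + dist X Z ^ 2 - dist Y Z ^ 2) / 2 + dist X Y ^ 2 := by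
  have h3 : ⟪Y - X, Y - X⟫ = dist X Y ^ 2 := by
    rw [real_inner_self_eq_norm_sq, dist_comm, dist_eq_norm]
  rw [← inner_half, ← h3, ← sub_sub_sub_cancel_right Q Y X, ← sub_sub_sub_cancel_right Z Y X]
  simp only [inner_sub_left (Q - X) (Y - X), inner_sub_right _ (Z - X) (Y - X)]
  ring

/-- In a circumscriptible tetrahedron, the normals to the faces at the face incenters are
concurrent: there is a point `Q` whose difference with each face incenter is orthogonal to
the plane of that face. -/
theorem circumscriptible_normals_at_incenters_concur
    (A1 A2 A3 A4 : EuclideanSpace ℝ (Fin 3))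
    (hind : AffineIndependent ℝ ![A1, A2, A3, A4])
    (hc1 : dist A2 A3 + dist A1 A4 = dist A3 A1 + dist A2 A4)
    (hc2 : dist A3 A1 + dist A2 A4 = dist A1 A2 + dist A3 A4) :
    ∃ Q : EuclideanSpace ℝ (Fin 3),
      (⟪Q - incenterPoint A2 A3 A4, A3 - A2⟫ = 0 ∧ ⟪Q - incenterPoint A2 A3 A4, A4 - A2⟫ = 0) ∧
      (⟪Q - incenterPoint A1 A3 A4, A3 - A1⟫ = 0 ∧ ⟪Q - incenterPoint A1 A3 A4, A4 - A1⟫ = 0) ∧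
      (⟪Q - incenterPoint A1 A2 A4, A2 - A1⟫ = 0 ∧ ⟪Q - incenterPoint A1 A2 A4, A4 - A1⟫ = 0) ∧
      (⟪Q - incenterPoint A1 A2 A3, A2 - A1⟫ = 0 ∧ ⟪Q - incenterPoint A1 A2 A3, A3 - A1⟫ = 0) := by
  have hinj := hind.injective
  have n12 : A1 ≠ A2 := fun h => absurd (@hinj 0 1 h) (by decide)
  have n13 : A1 ≠ A3 := fun h => absurd (@hinj 0 2 h) (by decide)
  have n23 : A2 ≠ A3 := fun h => absurd (@hinj 1 2 h) (by decide)
  have hli : LinearIndependent ℝ ![A2 - A1, A3 - A1, A4 - A1] := by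
    rw [affineIndependent_iff_linearIndependent_vsub ℝ _ (0 : Fin 4)] at hind
    have := hind.comp (fun i : Fin 3 => (⟨i.succ, Fin.succ_ne_zero i⟩ : {x : Fin 4 // x ≠ 0}))
      (fun i j h => by simpa using h)
    have e : ![A2 - A1, A3 - A1, A4 - A1] = ((fun i : {x : Fin 4 // x ≠ 0} =>
        ![A1, A2, A3, A4] ↑i -ᵥ ![A1, A2, A3, A4] 0) ∘
        fun i : Fin 3 => (⟨i.succ, Fin.succ_ne_zero i⟩ : {x : Fin 4 // x ≠ 0})) := by
      funext i
      fin_cases i <;> rfl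
    rw [e]
    exact this
  rw [dist_comm A3 A1] at hc1 hc2
  obtain ⟨q, hq⟩ := exists_inner _ hli (fun i => ![dist A1 A2, dist A1 A3, dist A1 A4] i *
    ((dist A1 A2 + dist A1 A3 - dist A2 A3) / 2))
  have q2 := hq 0
  have q3 := hq 1
  have q4 := hq 2
  simp at q2 q3 q4
  have hQ : q = (q + A1) - A1 := by simp
  generalize q + A1 = Q at hQ
  subst hQ
  have m3 := inner_move Q A1 A2 A3
  have m4 := inner_move Q A1 A2 A4
  have e14 : dist A1 A4 = dist A1 A3 + dist A2 A4 - dist A2 A3 := by linarith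
  have e34 : dist A3 A4 = dist A1 A3 + dist A2 A4 - dist A1 A2 := by linarith
  refine ⟨Q, face_aux _ _ _ _ n23 ?_ ?_, face_aux _ _ _ _ n13 ?_ ?_, face_aux _ _ _ _ n12 ?_ ?_,
    face_aux _ _ _ _ n12 ?_ ?_⟩
  · rw [m3, q2, q3, e34]; ring
  · rw [m4, q2, q4, e34, e14]; ring
  · rw [q3, e34, e14]; ring
  · rw [q4, e34, e14]; ring
  · rw [q2, e14]; ring
  · rw [q4, e14]; ring
  · rw [q2]
  · rw [q3]
end

section
/- Let A₁A₂A₃A₄ be an isodynamic tetrahedron in ℝ³, i.e. d(A₂,A₃)·d(A₁,A₄) = d(A₃,A₁)·d(A₂,A₄) = d(A₁,A₂)·d(A₃,A₄). For each i, let Iᵢ be the incenter of the face opposite Aᵢ. Then the four cevians joining Aᵢ to Iᵢ (i = 1,2,3,4) are concurrent: there is a point Q lying on all four lines. -/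
/-- A weighted combination whose weights at `X, Y, Z` are proportional to the incenter weights
lies on the cevian from `W`. -/
theorem mem_cevian_s10 (W X Y Z Q : EuclideanSpace ℝ (Fin 3)) (w p q r k : ℝ)
    (hXY : 0 < dist X Y) (hXZ : 0 < dist X Z) (hYZ : 0 < dist Y Z)
    (hS : 0 < w + p + q + r)
    (hp : p = k * dist Y Z) (hq : q = k * dist X Z) (hr : r = k * dist X Y)
    (hQ : Q = (1 / (w + p + q + r)) • (w • W + p • X + q • Y + r • Z)) :
    Q ∈ affineSpan ℝ ({W, incenterPoint X Y Z} : Set (EuclideanSpace ℝ (Fin 3))) := by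
  have h : Q = AffineMap.lineMap W (incenterPoint X Y Z) ((p + q + r) / (w + p + q + r)) := by
    rw [hQ, AffineMap.lineMap_apply_module, incenterPoint]
    subst hp hq hr
    generalize dist Y Z = a at *
    generalize dist X Z = b at *
    generalize dist X Y = c at *
    have h1 : a + b + c ≠ 0 := by positivity
    have h2 := hS.ne'
    match_scalars <;> field_simp <;> ring
  rw [h]
  exact AffineMap.lineMap_mem_affineSpan_pair _ _ _

/-- In an isodynamic tetrahedron, the four cevians from each vertex to the incenter of the
opposite face are concurrent. -/
theorem isodynamic_cevians_to_incenters_concur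
    (A1 A2 A3 A4 : EuclideanSpace ℝ (Fin 3))
    (hind : AffineIndependent ℝ ![A1, A2, A3, A4])
    (hc1 : dist A2 A3 * dist A1 A4 = dist A3 A1 * dist A2 A4)
    (hc2 : dist A3 A1 * dist A2 A4 = dist A1 A2 * dist A3 A4) :
    ∃ Q : EuclideanSpace ℝ (Fin 3),
      Q ∈ affineSpan ℝ ({A1, incenterPoint A2 A3 A4} : Set (EuclideanSpace ℝ (Fin 3))) ∧
      Q ∈ affineSpan ℝ ({A2, incenterPoint A1 A3 A4} : Set (EuclideanSpace ℝ (Fin 3))) ∧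
      Q ∈ affineSpan ℝ ({A3, incenterPoint A1 A2 A4} : Set (EuclideanSpace ℝ (Fin 3))) ∧
      Q ∈ affineSpan ℝ ({A4, incenterPoint A1 A2 A3} : Set (EuclideanSpace ℝ (Fin 3))) := by
  have hd : ∀ i j : Fin 4, i ≠ j →
      0 < dist (![A1, A2, A3, A4] i) (![A1, A2, A3, A4] j) := fun i j hij =>
    dist_pos.2 (fun h => hij (hind.injective h))
  have h12 : 0 < dist A1 A2 := hd 0 1 (by decide)
  have h13 : 0 < dist A1 A3 := hd 0 2 (by decide)
  have h14 : 0 < dist A1 A4 := hd 0 3 (by decide)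
  have h23 : 0 < dist A2 A3 := hd 1 2 (by decide)
  have h24 : 0 < dist A2 A4 := hd 1 3 (by decide)
  have h34 : 0 < dist A3 A4 := hd 2 3 (by decide)
  rw [dist_comm A3 A1] at hc1 hc2
  obtain ⟨w1, hw1⟩ : ∃ x, x = dist A3 A4 * dist A2 A3 := ⟨_, rfl⟩
  obtain ⟨w2, hw2⟩ : ∃ x, x = dist A3 A4 * dist A1 A3 := ⟨_, rfl⟩
  obtain ⟨w3, hw3⟩ : ∃ x, x = dist A2 A4 * dist A1 A3 := ⟨_, rfl⟩
  obtain ⟨w4, hw4⟩ : ∃ x, x = dist A2 A3 * dist A1 A3 := ⟨_, rfl⟩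
  have p1 : 0 < w1 := by rw [hw1]; positivity
  have p2 : 0 < w2 := by rw [hw2]; positivity
  have p3 : 0 < w3 := by rw [hw3]; positivity
  have p4 : 0 < w4 := by rw [hw4]; positivity
  refine ⟨(1 / (w1 + w2 + w3 + w4)) • (w1 • A1 + w2 • A2 + w3 • A3 + w4 • A4), ?_, ?_, ?_, ?_⟩
  · refine mem_cevian_s10 A1 A2 A3 A4 _ w1 w2 w3 w4 (dist A1 A3) h23 h24 h34 (by positivity)
      (by linarith) (by linarith) (by linarith) rfl
  · refine mem_cevian_s10 A2 A1 A3 A4 _ w2 w1 w3 w4 (dist A2 A3) h13 h14 h34 (by positivity)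
      (by linarith) (by linarith) (by linarith) ?_
    rw [add_comm w2 w1, add_comm (w2 • A2) (w1 • A1)]
  · refine mem_cevian_s10 A3 A1 A2 A4 _ w3 w1 w2 w4 (dist A3 A4 * dist A2 A3 / dist A2 A4)
      h12 h14 h24 (by positivity) ?_ ?_ ?_ ?_
    · rw [hw1]; field_simp
    · rw [hw2]; field_simp; linarith
    · rw [hw4]; field_simp; linarith
    · congr 1
      · congr 1; ring
      · abel
  · refine mem_cevian_s10 A4 A1 A2 A3 _ w4 w1 w2 w3 (dist A3 A4) h12 h13 h23 (by positivity)
      (by linarith) (by linarith) (by linarith) ?_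
    congr 1
    · congr 1; ring
    · abel
end

section
/- Let A₁A₂A₃A₄ be an orthocentric tetrahedron in ℝ³, i.e. d(A₂,A₃)² + d(A₁,A₄)² = d(A₃,A₁)² + d(A₂,A₄)² = d(A₁,A₂)² + d(A₃,A₄)². For each i, let Hᵢ be the orthocenter of the face opposite Aᵢ. Then the four cevians joining Aᵢ to Hᵢ (i = 1,2,3,4) are concurrent: there is a point Q lying on all four lines. -/
open scoped RealInnerProductSpace

/-- Only zero is orthogonal to all three edge vectors at the first vertex. -/
def EdgeNondeg (A B C D : EuclideanSpace ℝ (Fin 3)) : Prop :=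
  ∀ v : EuclideanSpace ℝ (Fin 3), ⟪v, B - A⟫ = 0 → ⟪v, C - A⟫ = 0 → ⟪v, D - A⟫ = 0 → v = 0

lemma EdgeNondeg.exists_inner {A B C D : EuclideanSpace ℝ (Fin 3)} (h : EdgeNondeg A B C D)
    (k : ℝ) : ∃ v : EuclideanSpace ℝ (Fin 3),
      ⟪v, B - A⟫ = k ∧ ⟪v, C - A⟫ = k ∧ ⟪v, D - A⟫ = k := by
  let f : EuclideanSpace ℝ (Fin 3) →ₗ[ℝ] (Fin 3 → ℝ) :=
    LinearMap.pi ![(innerₛₗ ℝ (B - A)), (innerₛₗ ℝ (C - A)), (innerₛₗ ℝ (D - A))]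
  have hf : ∀ v, f v = ![⟪v, B - A⟫, ⟪v, C - A⟫, ⟪v, D - A⟫] := by
    intro v
    ext i
    fin_cases i <;> simp [f, inner_sub_right, real_inner_comm v]
  have hinj : Function.Injective f := by
    rw [injective_iff_map_eq_zero]
    intro v hv
    rw [hf] at hv
    exact h v (congrFun hv 0) (congrFun hv 1) (congrFun hv 2)
  have hsurj : Function.Surjective f :=
    (LinearMap.injective_iff_surjective_of_finrank_eq_finrank (by simp)).1 hinj
  obtain ⟨v, hv⟩ := hsurj ![k, k, k]
  rw [hf] at hv
  exact ⟨v, congrFun hv 0, congrFun hv 1, congrFun hv 2⟩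

lemma EdgeNondeg.of_affineIndependent {A B C D : EuclideanSpace ℝ (Fin 3)}
    (h : AffineIndependent ℝ ![A, B, C, D]) : EdgeNondeg A B C D := by
  intro v hB hC hD
  have hs : affineSpan ℝ (Set.range ![A, B, C, D]) = ⊤ :=
    h.affineSpan_eq_top_iff_card_eq_finrank_add_one.2 (by simp)
  have key : ∀ x : EuclideanSpace ℝ (Fin 3), ⟪v, x - A⟫ = 0 := by
    intro x
    have hx : x ∈ affineSpan ℝ (Set.range ![A, B, C, D]) := by rw [hs]; trivial
    refine affineSpan_induction (p := fun x => ⟪v, x - A⟫ = 0) hx ?_ ?_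
    · intro y hy
      obtain ⟨i, rfl⟩ := hy
      fin_cases i <;> simp [hB, hC, hD]
    · intro c u w z hu hw hz
      simp only [vsub_eq_sub, vadd_eq_add, inner_sub_right, inner_add_right,
        inner_smul_right] at *
      linear_combination c * hu - c * hw + hz
  have := key (v + A)
  simpa using this

lemma cevian_mem {A B C D H Q : EuclideanSpace ℝ (Fin 3)} (hN : EdgeNondeg A B C D)
    (hH : H ∈ affineSpan ℝ ({B, C, D} : Set (EuclideanSpace ℝ (Fin 3))))
    (h1 : ⟪H - A, C - B⟫ = 0) (h2 : ⟪H - A, D - B⟫ = 0)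
    (q1 : ⟪Q - A, C - B⟫ = 0) (q2 : ⟪Q - A, D - B⟫ = 0) :
    Q ∈ affineSpan ℝ ({A, H} : Set (EuclideanSpace ℝ (Fin 3))) := by
  obtain ⟨n, nB, nC, nD⟩ := hN.exists_inner 1
  have hn : ⟪n, H - A⟫ = 1 := by
    clear h1 h2
    refine affineSpan_induction (p := fun x => ⟪n, x - A⟫ = 1) hH ?_ ?_
    · intro y hy
      rcases hy with rfl | rfl | rfl <;> assumption
    · intro c u w z hu hw hz
      simp only [vsub_eq_sub, vadd_eq_add, inner_sub_right, inner_add_right,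
        inner_smul_right] at *
      linear_combination c * hu - c * hw + hz
  have hs : ⟪H - A, B - A⟫ ≠ 0 := by
    intro h0
    have : H - A = 0 := by
      apply hN _ h0 <;> simp only [inner_sub_right] at * <;> linarith
    simp [this] at hn
  have hq : Q - A - (⟪Q - A, B - A⟫ / ⟪H - A, B - A⟫) • (H - A) = 0 := by
    have e : ⟪Q - A, B - A⟫ / ⟪H - A, B - A⟫ * ⟪H - A, B - A⟫ = ⟪Q - A, B - A⟫ :=
      div_mul_cancel₀ _ hs
    generalize ⟪Q - A, B - A⟫ / ⟪H - A, B - A⟫ = t at *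
    apply hN
    · rw [inner_sub_left, real_inner_smul_left]; linarith
    · rw [inner_sub_left, real_inner_smul_left, ← sub_add_sub_cancel C B A,
        inner_add_right, inner_add_right, h1, q1]; linarith
    · rw [inner_sub_left, real_inner_smul_left, ← sub_add_sub_cancel D B A,
        inner_add_right, inner_add_right, h2, q2]; linarith
  have : Q = AffineMap.lineMap A H (⟪Q - A, B - A⟫ / ⟪H - A, B - A⟫) := by
    rw [AffineMap.lineMap_apply, vsub_eq_sub, vadd_eq_add, ← sub_eq_zero, ← hq]
    abel
  rw [this]
  exact AffineMap.lineMap_mem_affineSpan_pair _ _ _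

/-- In an orthocentric tetrahedron, the four cevians from each vertex to the orthocenter of
the opposite face are concurrent. -/
theorem orthocentric_cevians_to_orthocenters_concur
    (A1 A2 A3 A4 H1 H2 H3 H4 : EuclideanSpace ℝ (Fin 3))
    (hind : AffineIndependent ℝ ![A1, A2, A3, A4])
    (hc1 : dist A2 A3 ^ 2 + dist A1 A4 ^ 2 = dist A3 A1 ^ 2 + dist A2 A4 ^ 2)
    (hc2 : dist A3 A1 ^ 2 + dist A2 A4 ^ 2 = dist A1 A2 ^ 2 + dist A3 A4 ^ 2)
    (hH1mem : H1 ∈ affineSpan ℝ ({A2, A3, A4} : Set (EuclideanSpace ℝ (Fin 3))))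
    (hH1 : ⟪H1 - A2, A3 - A4⟫ = 0 ∧ ⟪H1 - A3, A4 - A2⟫ = 0)
    (hH2mem : H2 ∈ affineSpan ℝ ({A1, A3, A4} : Set (EuclideanSpace ℝ (Fin 3))))
    (hH2 : ⟪H2 - A1, A3 - A4⟫ = 0 ∧ ⟪H2 - A3, A4 - A1⟫ = 0)
    (hH3mem : H3 ∈ affineSpan ℝ ({A1, A2, A4} : Set (EuclideanSpace ℝ (Fin 3))))
    (hH3 : ⟪H3 - A1, A2 - A4⟫ = 0 ∧ ⟪H3 - A2, A4 - A1⟫ = 0)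
    (hH4mem : H4 ∈ affineSpan ℝ ({A1, A2, A3} : Set (EuclideanSpace ℝ (Fin 3))))
    (hH4 : ⟪H4 - A1, A2 - A3⟫ = 0 ∧ ⟪H4 - A2, A3 - A1⟫ = 0) :
    ∃ Q : EuclideanSpace ℝ (Fin 3),
      Q ∈ affineSpan ℝ ({A1, H1} : Set (EuclideanSpace ℝ (Fin 3))) ∧
      Q ∈ affineSpan ℝ ({A2, H2} : Set (EuclideanSpace ℝ (Fin 3))) ∧
      Q ∈ affineSpan ℝ ({A3, H3} : Set (EuclideanSpace ℝ (Fin 3))) ∧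
      Q ∈ affineSpan ℝ ({A4, H4} : Set (EuclideanSpace ℝ (Fin 3))) := by
  have hN := EdgeNondeg.of_affineIndependent hind
  obtain ⟨q, qB, qC, qD⟩ := hN.exists_inner ⟪A2 - A1, A3 - A1⟫
  obtain ⟨a1, b1⟩ := hH1
  obtain ⟨a2, b2⟩ := hH2
  obtain ⟨a3, b3⟩ := hH3
  obtain ⟨a4, b4⟩ := hH4
  simp only [dist_eq_norm, ← real_inner_self_eq_norm_sq] at hc1 hc2
  have N2 : EdgeNondeg A2 A1 A3 A4 := by
    intro v u1 u2 u3
    apply hN v <;> simp only [inner_sub_right] at * <;> linarith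
  have N3 : EdgeNondeg A3 A1 A2 A4 := by
    intro v u1 u2 u3
    apply hN v <;> simp only [inner_sub_right] at * <;> linarith
  have N4 : EdgeNondeg A4 A1 A2 A3 := by
    intro v u1 u2 u3
    apply hN v <;> simp only [inner_sub_right] at * <;> linarith
  clear hind
  have c12 := real_inner_comm A1 A2
  have c13 := real_inner_comm A1 A3
  have c14 := real_inner_comm A1 A4
  have c23 := real_inner_comm A2 A3
  have c24 := real_inner_comm A2 A4
  have c34 := real_inner_comm A3 A4
  refine ⟨q + A1, cevian_mem hN hH1mem ?_ ?_ ?_ ?_, cevian_mem N2 hH2mem ?_ ?_ ?_ ?_,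
    cevian_mem N3 hH3mem ?_ ?_ ?_ ?_, cevian_mem N4 hH4mem ?_ ?_ ?_ ?_⟩ <;>
  · clear hH1mem hH2mem hH3mem hH4mem
    simp only [inner_sub_right, inner_sub_left, inner_add_left] at *
    linarith
end

section
/- Let A₁A₂A₃A₄ be an orthocentric tetrahedron in ℝ³, i.e. d(A₂,A₃)² + d(A₁,A₄)² = d(A₃,A₁)² + d(A₂,A₄)² = d(A₁,A₂)² + d(A₃,A₄)². For each i, let Gᵢ be the centroid of the face opposite Aᵢ. Then the four normals to the faces at the face centroids are concurrent: there is a point Q such that for each i, Q − Gᵢ is orthogonal to the plane of face i. -/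
open scoped RealInnerProductSpace

/-- In an orthocentric tetrahedron, the normals to the faces at the face centroids are
concurrent: there is a point `Q` whose difference with each face centroid is orthogonal to
the plane of that face. -/
theorem orthocentric_normals_at_face_centroids_concur
    (A1 A2 A3 A4 : EuclideanSpace ℝ (Fin 3))
    (hind : AffineIndependent ℝ ![A1, A2, A3, A4])
    (hc1 : dist A2 A3 ^ 2 + dist A1 A4 ^ 2 = dist A3 A1 ^ 2 + dist A2 A4 ^ 2)
    (hc2 : dist A3 A1 ^ 2 + dist A2 A4 ^ 2 = dist A1 A2 ^ 2 + dist A3 A4 ^ 2)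
    (G1 G2 G3 G4 : EuclideanSpace ℝ (Fin 3))
    (hG1 : G1 = (1/3 : ℝ) • (A2 + A3 + A4))
    (hG2 : G2 = (1/3 : ℝ) • (A1 + A3 + A4))
    (hG3 : G3 = (1/3 : ℝ) • (A1 + A2 + A4))
    (hG4 : G4 = (1/3 : ℝ) • (A1 + A2 + A3)) :
    ∃ Q : EuclideanSpace ℝ (Fin 3),
      (⟪Q - G1, A3 - A2⟫ = 0 ∧ ⟪Q - G1, A4 - A2⟫ = 0) ∧
      (⟪Q - G2, A3 - A1⟫ = 0 ∧ ⟪Q - G2, A4 - A1⟫ = 0) ∧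
      (⟪Q - G3, A2 - A1⟫ = 0 ∧ ⟪Q - G3, A4 - A1⟫ = 0) ∧
      (⟪Q - G4, A2 - A1⟫ = 0 ∧ ⟪Q - G4, A3 - A1⟫ = 0) := by
  have hli := (affineIndependent_iff_linearIndependent_vsub ℝ _ (0 : Fin 4)).1 hind
  have hli3 := hli.comp (fun i : Fin 3 => (⟨i.succ, Fin.succ_ne_zero i⟩ : {x : Fin 4 // x ≠ 0}))
    (fun i j h => by simpa using h)
  let b := basisOfLinearIndependentOfCardEqFinrank hli3 (by simp)
  -- the orthocenter
  let f : EuclideanSpace ℝ (Fin 3) →ₗ[ℝ] ℝ :=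
    b.constr ℝ ![⟪A3, A2 - A1⟫, ⟪A2, A3 - A1⟫, ⟪A2, A4 - A1⟫]
  obtain ⟨H, hH⟩ : ∃ H : EuclideanSpace ℝ (Fin 3), ∀ v, ⟪H, v⟫ = f v :=
    ⟨(InnerProductSpace.toDual ℝ _).symm (LinearMap.toContinuousLinearMap f), fun v => by simp⟩
  have b0 : b 0 = A2 - A1 := by simp [b]
  have b1 : b 1 = A3 - A1 := by simp [b]
  have b2 : b 2 = A4 - A1 := by simp [b]
  have h0 : ⟪H, A2 - A1⟫ = ⟪A3, A2 - A1⟫ := by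
    rw [hH, ← b0, b.constr_basis]; simp [b0]
  have h1 : ⟪H, A3 - A1⟫ = ⟪A2, A3 - A1⟫ := by
    rw [hH, ← b1, b.constr_basis]; simp [b1]
  have h2 : ⟪H, A4 - A1⟫ = ⟪A2, A4 - A1⟫ := by
    rw [hH, ← b2, b.constr_basis]; simp [b2]
  simp only [dist_eq_norm, ← real_inner_self_eq_norm_sq] at hc1 hc2
  subst hG1 hG2 hG3 hG4
  have c12 := real_inner_comm A1 A2
  have c13 := real_inner_comm A1 A3
  have c14 := real_inner_comm A1 A4
  have c23 := real_inner_comm A2 A3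
  have c24 := real_inner_comm A2 A4
  have c34 := real_inner_comm A3 A4
  refine ⟨(1/3 : ℝ) • (A1 + A2 + A3 + A4 - H), ?_⟩
  simp only [inner_sub_left, inner_sub_right, inner_add_left, real_inner_smul_left] at *
  refine ⟨⟨?_, ?_⟩, ⟨?_, ?_⟩, ⟨?_, ?_⟩, ⟨?_, ?_⟩⟩ <;> linarith
end

section
/- Let A₁A₂A₃A₄ be a tetrahedron in ℝ³. Let P₁ = y₁A₂ + z₁A₃ + w₁A₄ with y₁ + z₁ + w₁ = 1 be a point in the plane of the face opposite A₁, and let P₂ = x₂A₁ + z₂A₃ + w₂A₄ with x₂ + z₂ + w₂ = 1 be a point in the plane of the face opposite A₂. Then the four points A₁, P₁, A₂, P₂ are coplanar (equivalently, the cevian lines A₁P₁ and A₂P₂ intersect or are parallel) if and only if z₁·w₂ = z₂·w₁. -/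
theorem affInd_four_iff {V : Type*} [AddCommGroup V] [Module ℝ V] (a b c d : V) :
    AffineIndependent ℝ ![a, b, c, d] ↔ ∀ α β γ δ : ℝ, α + β + γ + δ = 0 →
      α • a + β • b + γ • c + δ • d = 0 → α = 0 ∧ β = 0 ∧ γ = 0 ∧ δ = 0 := by
  rw [affineIndependent_iff]
  constructor
  · intro h α β γ δ hs hv
    have := h Finset.univ ![α, β, γ, δ] (by simpa [Fin.sum_univ_four] using hs)
      (by simpa [Fin.sum_univ_four] using hv)
    exact ⟨this 0 (by simp), this 1 (by simp), this 2 (by simp), this 3 (by simp)⟩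
  · intro h s w hs hv
    let w' : Fin 4 → ℝ := fun i => if i ∈ s then w i else 0
    have h1 : ∑ i, w' i = 0 := by
      simpa [w', Finset.sum_ite_mem] using hs
    have h2 : ∑ i, w' i • ![a, b, c, d] i = 0 := by
      simpa [w', ite_smul, Finset.sum_ite_mem] using hv
    rw [Fin.sum_univ_four] at h1 h2
    obtain ⟨e0, e1, e2, e3⟩ := h (w' 0) (w' 1) (w' 2) (w' 3) h1 (by simpa using h2)
    have h3 : ∀ i, w' i = 0 := by
      intro i
      fin_cases i
      exacts [e0, e1, e2, e3]
    intro i hi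
    simpa [w', hi] using h3 i

/-- Let `P₁ = y₁A₂ + z₁A₃ + w₁A₄` be a point in the plane of the face opposite `A₁` and
`P₂ = x₂A₁ + z₂A₃ + w₂A₄` a point in the plane of the face opposite `A₂` of a tetrahedron
`A₁A₂A₃A₄`. Then `A₁`, `P₁`, `A₂`, `P₂` are coplanar (i.e., the cevians `A₁P₁` and `A₂P₂`
intersect or are parallel) if and only if `z₁w₂ = z₂w₁`. -/
theorem cevians_coplanar_iff
    (A1 A2 A3 A4 : EuclideanSpace ℝ (Fin 3))
    (hind : AffineIndependent ℝ ![A1, A2, A3, A4])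
    (y1 z1 w1 x2 z2 w2 : ℝ)
    (hs1 : y1 + z1 + w1 = 1) (hs2 : x2 + z2 + w2 = 1)
    (P1 P2 : EuclideanSpace ℝ (Fin 3))
    (hP1 : P1 = y1 • A2 + z1 • A3 + w1 • A4)
    (hP2 : P2 = x2 • A1 + z2 • A3 + w2 • A4) :
    Coplanar ℝ ({A1, P1, A2, P2} : Set (EuclideanSpace ℝ (Fin 3))) ↔ z1 * w2 = z2 * w1 := by
  have hset : ({A1, P1, A2, P2} : Set (EuclideanSpace ℝ (Fin 3)))
      = Set.range ![A1, P1, A2, P2] := by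
    simp only [Matrix.range_cons, Matrix.range_empty, Set.union_empty, Set.singleton_union]
  have key : Coplanar ℝ ({A1, P1, A2, P2} : Set (EuclideanSpace ℝ (Fin 3))) ↔
      ¬ AffineIndependent ℝ ![A1, P1, A2, P2] := by
    rw [coplanar_iff_finrank_le_two, hset,
      affineIndependent_iff_not_finrank_vectorSpan_le ℝ _ (n := 2) (by simp), not_not]
  rw [key, affInd_four_iff]
  rw [affInd_four_iff] at hind
  have comb : ∀ α β γ δ : ℝ, α • A1 + β • P1 + γ • A2 + δ • P2 =
      (α + δ * x2) • A1 + (β * y1 + γ) • A2 + (β * z1 + δ * z2) • A3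
        + (β * w1 + δ * w2) • A4 := by
    intro α β γ δ
    rw [hP1, hP2]
    module
  constructor
  · intro h
    by_contra hne
    apply h
    intro α β γ δ hs hv
    rw [comb] at hv
    obtain ⟨e1, e2, e3, e4⟩ := hind _ _ _ _
      (by linear_combination hs + β * hs1 + δ * hs2) hv
    have hd : z1 * w2 - z2 * w1 ≠ 0 := sub_ne_zero.2 hne
    have hβ : β = 0 := by
      have : β * (z1 * w2 - z2 * w1) = 0 := by linear_combination w2 * e3 - z2 * e4
      exact (mul_eq_zero.1 this).resolve_right hd
    have hδ : δ = 0 := by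
      have : δ * (z1 * w2 - z2 * w1) = 0 := by linear_combination z1 * e4 - w1 * e3
      exact (mul_eq_zero.1 this).resolve_right hd
    subst hβ hδ
    exact ⟨by simpa using e1, rfl, by simpa using e2, rfl⟩
  · intro hd h
    have sol : ∀ β δ : ℝ, β * z1 + δ * z2 = 0 → β * w1 + δ * w2 = 0 → β = 0 ∧ δ = 0 := by
      intro β δ e3 e4
      obtain ⟨-, hb, -, hc⟩ := h (-(δ * x2)) β (-(β * y1)) δ
        (by linear_combination e3 + e4 - β * hs1 - δ * hs2)
        (by rw [comb, e3, e4]; simp)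
      exact ⟨hb, hc⟩
    obtain ⟨a1, a2⟩ := sol z2 (-z1) (by ring) (by linear_combination -hd)
    obtain ⟨b1, b2⟩ := sol w2 (-w1) (by linear_combination hd) (by ring)
    have c1 : z1 = 0 := neg_eq_zero.1 a2
    have c2 : w1 = 0 := neg_eq_zero.1 b2
    exact one_ne_zero (sol 1 0 (by simp [c1]) (by simp [c2])).1
end

section
/- Let A₁A₂A₃A₄ be a tetrahedron in ℝ³, and for i = 1, 2, 3 let Pᵢ be a point in the interior of the face opposite Aᵢ (i.e., Pᵢ is a barycentric combination of the three vertices other than Aᵢ with strictly positive coefficients summing to 1). Let ℓᵢ be the line through Aᵢ and Pᵢ. If each pair of the lines ℓ₁, ℓ₂, ℓ₃ has a common point, then the three lines have a common point (they are concurrent). -/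
theorem coeffs_zero_aux (A1 A2 A3 A4 : EuclideanSpace ℝ (Fin 3))
    (hind : AffineIndependent ℝ ![A1, A2, A3, A4]) (a b c d : ℝ)
    (hs : a + b + c + d = 0) (h : a • A1 + b • A2 + c • A3 + d • A4 = 0) :
    a = 0 ∧ b = 0 ∧ c = 0 ∧ d = 0 := by
  rw [affineIndependent_iff] at hind
  have h0 := hind Finset.univ ![a, b, c, d] (by simpa [Fin.sum_univ_four] using hs)
    (by simpa [Fin.sum_univ_four] using h)
  exact ⟨by simpa using h0 0 (Finset.mem_univ _), by simpa using h0 1 (Finset.mem_univ _),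
    by simpa using h0 2 (Finset.mem_univ _), by simpa using h0 3 (Finset.mem_univ _)⟩

/-- If the cevians from `A₁`, `A₂`, `A₃` of a tetrahedron to interior points of the opposite
faces meet in pairs, then all three cevians meet at a single point. -/
theorem cevians_pairwise_meet_implies_concurrent
    (A1 A2 A3 A4 : EuclideanSpace ℝ (Fin 3))
    (hind : AffineIndependent ℝ ![A1, A2, A3, A4])
    (y1 z1 w1 x2 z2 w2 x3 y3 w3 : ℝ)
    (hy1 : 0 < y1) (hz1 : 0 < z1) (hw1 : 0 < w1) (hs1 : y1 + z1 + w1 = 1)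
    (hx2 : 0 < x2) (hz2 : 0 < z2) (hw2 : 0 < w2) (hs2 : x2 + z2 + w2 = 1)
    (hx3 : 0 < x3) (hy3 : 0 < y3) (hw3 : 0 < w3) (hs3 : x3 + y3 + w3 = 1)
    (P1 P2 P3 : EuclideanSpace ℝ (Fin 3))
    (hP1 : P1 = y1 • A2 + z1 • A3 + w1 • A4)
    (hP2 : P2 = x2 • A1 + z2 • A3 + w2 • A4)
    (hP3 : P3 = x3 • A1 + y3 • A2 + w3 • A4)
    (h12 : ∃ Q : EuclideanSpace ℝ (Fin 3),
      Q ∈ affineSpan ℝ ({A1, P1} : Set (EuclideanSpace ℝ (Fin 3))) ∧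
      Q ∈ affineSpan ℝ ({A2, P2} : Set (EuclideanSpace ℝ (Fin 3))))
    (h13 : ∃ Q : EuclideanSpace ℝ (Fin 3),
      Q ∈ affineSpan ℝ ({A1, P1} : Set (EuclideanSpace ℝ (Fin 3))) ∧
      Q ∈ affineSpan ℝ ({A3, P3} : Set (EuclideanSpace ℝ (Fin 3))))
    (h23 : ∃ Q : EuclideanSpace ℝ (Fin 3),
      Q ∈ affineSpan ℝ ({A2, P2} : Set (EuclideanSpace ℝ (Fin 3))) ∧
      Q ∈ affineSpan ℝ ({A3, P3} : Set (EuclideanSpace ℝ (Fin 3)))) :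
    ∃ Q : EuclideanSpace ℝ (Fin 3),
      Q ∈ affineSpan ℝ ({A1, P1} : Set (EuclideanSpace ℝ (Fin 3))) ∧
      Q ∈ affineSpan ℝ ({A2, P2} : Set (EuclideanSpace ℝ (Fin 3))) ∧
      Q ∈ affineSpan ℝ ({A3, P3} : Set (EuclideanSpace ℝ (Fin 3))) := by
  simp only [mem_affineSpan_pair_iff_exists_lineMap_eq,
    AffineMap.lineMap_apply_module] at h12 h13 h23 ⊢
  obtain ⟨Q, ⟨t, ht⟩, ⟨s, hs⟩⟩ := h12
  obtain ⟨Q', ⟨t', ht'⟩, ⟨r, hr⟩⟩ := h13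
  obtain ⟨Q'', ⟨s', hs'⟩, ⟨r', hr'⟩⟩ := h23
  obtain ⟨a1, a2, a3, a4⟩ := coeffs_zero_aux A1 A2 A3 A4 hind
    ((1 - t) - s * x2) (t * y1 - (1 - s)) (t * z1 - s * z2) (t * w1 - s * w2)
    (by linear_combination t * hs1 - s * hs2)
    (by
      have h := ht.trans hs.symm
      rw [← sub_eq_zero, hP1, hP2] at h
      rw [← h]; module)
  obtain ⟨b1, b2, b3, b4⟩ := coeffs_zero_aux A1 A2 A3 A4 hind
    ((1 - t') - r * x3) (t' * y1 - r * y3) (t' * z1 - (1 - r)) (t' * w1 - r * w3)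
    (by linear_combination t' * hs1 - r * hs3)
    (by
      have h := ht'.trans hr.symm
      rw [← sub_eq_zero, hP1, hP3] at h
      rw [← h]; module)
  obtain ⟨c1, c2, c3, c4⟩ := coeffs_zero_aux A1 A2 A3 A4 hind
    (s' * x2 - r' * x3) ((1 - s') - r' * y3) (s' * z2 - (1 - r')) (s' * w2 - r' * w3)
    (by linear_combination s' * hs2 - r' * hs3)
    (by
      have h := hs'.trans hr'.symm
      rw [← sub_eq_zero, hP2, hP3] at h
      rw [← h]; module)
  have hs0 : s' ≠ 0 := by
    rintro rfl
    have h1 : r' = 0 := by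
      have : r' * w3 = 0 := by linarith
      exact (mul_eq_zero.mp this).resolve_right hw3.ne'
    subst h1
    linarith
  have hx : x2 * w3 = x3 * w2 := by
    apply mul_left_cancel₀ hs0
    linear_combination w3 * c1 - x3 * c4
  have e1 : t * (w2 + w1 * x2) = w2 := by linear_combination -w2 * a1 + x2 * a4
  have e2 : t' * (w3 + w1 * x3) = w3 := by linear_combination -w3 * b1 + x3 * b4
  have htt : t = t' := by
    have hpos : w3 * (w2 + w1 * x2) ≠ 0 := by positivity
    apply mul_right_cancel₀ hpos
    linear_combination w3 * e1 - w2 * e2 - t' * w1 * hx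
  refine ⟨Q, ⟨t, ht⟩, ⟨s, hs⟩, ⟨r, ?_⟩⟩
  rw [hr, ← ht', ← htt, ht]
end

section
/- Let A₁A₂A₃A₄ be a tetrahedron in ℝ³, and for each i let Γᵢ be the Gergonne point of the face opposite Aᵢ. If the four cevian lines joining Aᵢ to Γᵢ (i = 1,2,3,4) have a common point, then the tetrahedron is circumscriptible: d(A₂,A₃)+d(A₁,A₄) = d(A₃,A₁)+d(A₂,A₄) = d(A₁,A₂)+d(A₃,A₄). -/
lemma strict_tri_s17 {X Y Z : EuclideanSpace ℝ (Fin 3)}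
    (h : ∀ p q r : ℝ, p + q + r = 0 → p • X + q • Y + r • Z = 0 → p = 0) :
    0 < dist X Y + dist X Z - dist Y Z := by
  have h1 : dist Y Z ≤ dist Y X + dist X Z := dist_triangle _ _ _
  rw [dist_comm Y X] at h1
  rcases h1.lt_or_eq with h2 | h2
  · linarith
  · exfalso
    have h3 : dist Y X + dist X Z = dist Y Z := by rw [dist_comm Y X]; exact h2.symm
    rw [dist_add_dist_eq_iff] at h3
    obtain ⟨t, -, ht⟩ := h3
    rw [AffineMap.lineMap_apply_module] at ht
    have := h (-1) (1 - t) t (by ring) (by rw [← ht]; module)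
    norm_num at this

lemma line_rep {A X Y Z Q : EuclideanSpace ℝ (Fin 3)}
    (hX : 0 < dist X Y + dist X Z - dist Y Z)
    (hY : 0 < dist Y X + dist Y Z - dist X Z)
    (hZ : 0 < dist Z X + dist Z Y - dist X Y)
    (hQ : Q ∈ affineSpan ℝ ({A, gergonnePoint X Y Z} : Set (EuclideanSpace ℝ (Fin 3)))) :
    ∃ m x y z k : ℝ, m + x + y + z = 1 ∧ Q = m • A + x • X + y • Y + z • Z ∧
      x * (dist X Y + dist X Z - dist Y Z) = k ∧ y * (dist Y X + dist Y Z - dist X Z) = k ∧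
      z * (dist Z X + dist Z Y - dist X Y) = k := by
  obtain ⟨t, rfl⟩ := mem_affineSpan_pair_iff_exists_lineMap_eq.1 hQ
  rw [AffineMap.lineMap_apply_module]
  unfold gergonnePoint
  simp only
  set a := dist X Y + dist X Z - dist Y Z
  set b := dist Y X + dist Y Z - dist X Z
  set c := dist Z X + dist Z Y - dist X Y
  have hs : 0 < 1 / a + 1 / b + 1 / c := by positivity
  set s := 1 / a + 1 / b + 1 / c with hsd
  refine ⟨1 - t, t * (1 / s) * (1 / a), t * (1 / s) * (1 / b), t * (1 / s) * (1 / c),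
    t * (1 / s), ?_, by module, by field_simp, by field_simp, by field_simp⟩
  have : 1 - t + t * (1 / s) * (1 / a) + t * (1 / s) * (1 / b) + t * (1 / s) * (1 / c)
    = 1 - t + t * (1 / s) * s := by rw [hsd]; ring
  rw [this]
  field_simp
  ring

lemma cross {x y k l c p r : ℝ} (hx : x ≠ 0) (hc : 0 < c)
    (h1 : x * (c + p) = k) (h2 : y * (c - p) = k)
    (h3 : x * (c + r) = l) (h4 : y * (c - r) = l) : p = r := by
  have e1 : x * (p - r) = k - l := by linarith
  have e2 : y * (p - r) = l - k := by linarith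
  have e3 : (x + y) * (p - r) = 0 := by linarith
  rcases mul_eq_zero.1 e3 with h | h
  · exfalso
    have : y = -x := by linarith
    subst this
    have : x * c = 0 := by linarith
    rcases mul_eq_zero.1 this with h | h
    · exact hx h
    · exact hc.ne' h
  · linarith

/-- If the four cevians from the vertices of a tetrahedron to the Gergonne points of the
opposite faces are concurrent, then the tetrahedron is circumscriptible (the three sums of
opposite edge lengths are equal). -/
theorem cevians_to_gergonne_points_concur_implies_circumscriptible
    (A1 A2 A3 A4 : EuclideanSpace ℝ (Fin 3))
    (hind : AffineIndependent ℝ ![A1, A2, A3, A4])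
    (hconc : ∃ Q : EuclideanSpace ℝ (Fin 3),
      Q ∈ affineSpan ℝ ({A1, gergonnePoint A2 A3 A4} : Set (EuclideanSpace ℝ (Fin 3))) ∧
      Q ∈ affineSpan ℝ ({A2, gergonnePoint A1 A3 A4} : Set (EuclideanSpace ℝ (Fin 3))) ∧
      Q ∈ affineSpan ℝ ({A3, gergonnePoint A1 A2 A4} : Set (EuclideanSpace ℝ (Fin 3))) ∧
      Q ∈ affineSpan ℝ ({A4, gergonnePoint A1 A2 A3} : Set (EuclideanSpace ℝ (Fin 3)))) :
    dist A2 A3 + dist A1 A4 = dist A3 A1 + dist A2 A4 ∧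
    dist A3 A1 + dist A2 A4 = dist A1 A2 + dist A3 A4 := by
  have H : ∀ a b c d : ℝ, a + b + c + d = 0 → a • A1 + b • A2 + c • A3 + d • A4 = 0 →
      a = 0 ∧ b = 0 ∧ c = 0 ∧ d = 0 := by
    intro a b c d h0 h1
    rw [affineIndependent_iff] at hind
    have := hind Finset.univ ![a, b, c, d] (by simp [Fin.sum_univ_four, h0])
      (by simpa [Fin.sum_univ_four] using h1)
    exact ⟨by simpa using this 0, by simpa using this 1, by simpa using this 2,
      by simpa using this 3⟩
  have T : ∀ {X Y Z : EuclideanSpace ℝ (Fin 3)},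
      (∀ p q r : ℝ, p + q + r = 0 → p • X + q • Y + r • Z = 0 → p = 0 ∧ q = 0 ∧ r = 0) →
      0 < dist X Y + dist X Z - dist Y Z ∧ 0 < dist Y X + dist Y Z - dist X Z ∧
      0 < dist Z X + dist Z Y - dist X Y := by
    intro X Y Z h
    refine ⟨strict_tri_s17 fun p q r h0 h1 => (h p q r h0 h1).1,
      strict_tri_s17 fun p q r h0 h1 => (h q p r (by linarith) (by rw [← h1]; module)).2.1,
      strict_tri_s17 fun p q r h0 h1 => (h q r p (by linarith) (by rw [← h1]; module)).2.2⟩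
  obtain ⟨a1, a2, a3⟩ := T (X := A2) (Y := A3) (Z := A4) fun p q r h0 h1 => by
    have := H 0 p q r (by linarith) (by rw [← h1]; module)
    tauto
  obtain ⟨b1, b2, b3⟩ := T (X := A1) (Y := A3) (Z := A4) fun p q r h0 h1 => by
    have := H p 0 q r (by linarith) (by rw [← h1]; module)
    tauto
  obtain ⟨c1, c2, c3⟩ := T (X := A1) (Y := A2) (Z := A4) fun p q r h0 h1 => by
    have := H p q 0 r (by linarith) (by rw [← h1]; module)
    tauto
  obtain ⟨d1, d2, d3⟩ := T (X := A1) (Y := A2) (Z := A3) fun p q r h0 h1 => by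
    have := H p q r 0 (by linarith) (by rw [← h1]; module)
    tauto
  obtain ⟨Q, q1, q2, q3, q4⟩ := hconc
  obtain ⟨w1, w2, w3, w4, k1, s1, e1, f1, g1, i1⟩ := line_rep a1 a2 a3 q1
  obtain ⟨x2, x1, x3, x4, k2, s2, e2, f2, g2, i2⟩ := line_rep b1 b2 b3 q2
  obtain ⟨y3, y1, y2, y4, k3, s3, e3, f3, g3, i3⟩ := line_rep c1 c2 c3 q3
  obtain ⟨z4, z1, z2, z3, k4, s4, e4, f4, g4, i4⟩ := line_rep d1 d2 d3 q4
  have X := H (x1 - w1) (x2 - w2) (x3 - w3) (x4 - w4) (by linarith) (by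
    have := sub_eq_zero.2 (e2.symm.trans e1)
    rw [← this]; module)
  have Y := H (y1 - w1) (y2 - w2) (y3 - w3) (y4 - w4) (by linarith) (by
    have := sub_eq_zero.2 (e3.symm.trans e1)
    rw [← this]; module)
  have Z := H (z1 - w1) (z2 - w2) (z3 - w3) (z4 - w4) (by linarith) (by
    have := sub_eq_zero.2 (e4.symm.trans e1)
    rw [← this]; module)
  simp only [sub_eq_zero] at X Y Z
  obtain ⟨rfl, rfl, rfl, rfl⟩ := X
  obtain ⟨rfl, rfl, rfl, rfl⟩ := Y
  obtain ⟨rfl, rfl, rfl, rfl⟩ := Z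
  have n2 : z2 ≠ 0 := by
    intro h
    subst h
    rw [zero_mul] at f1
    subst f1
    have h3 : z3 = 0 := (mul_eq_zero.1 g1).resolve_right a2.ne'
    have h4 : z4 = 0 := (mul_eq_zero.1 i1).resolve_right a3.ne'
    rw [h3, zero_mul] at g2
    subst g2
    have h1 : z1 = 0 := (mul_eq_zero.1 f2).resolve_right b1.ne'
    linarith
  have p12 : 0 < dist A1 A2 := by
    have := dist_comm A1 A2
    linarith
  have p23 : 0 < dist A2 A3 := by
    have := dist_comm A2 A3
    linarith
  simp only [dist_comm A2 A1, dist_comm A3 A1, dist_comm A4 A1, dist_comm A3 A2,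
    dist_comm A4 A2, dist_comm A4 A3] at *
  have r1 := cross (x := z2) (y := z3) (k := k1) (l := k4) (c := dist A2 A3)
    (p := dist A2 A4 - dist A3 A4) (r := dist A1 A2 - dist A1 A3) n2 p23
    (by rw [← f1]; ring) (by rw [← g1]; ring) (by rw [← g4]; ring) (by rw [← i4]; ring)
  have r2 := cross (x := z2) (y := z1) (k := k3) (l := k4) (c := dist A1 A2)
    (p := dist A2 A4 - dist A1 A4) (r := dist A2 A3 - dist A1 A3) n2 p12
    (by rw [← g3]; ring) (by rw [← f3]; ring) (by rw [← g4]; ring) (by rw [← f4]; ring)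
  constructor <;> linarith
end

section
/- Let A₁A₂A₃A₄ be a tetrahedron in ℝ³, let P₁ be a point in the affine plane of the face A₂A₃A₄, and let P₂ be a point in the affine plane of the face A₁A₃A₄. Suppose there exists a point P such that P − P₁ is orthogonal to the plane of A₂A₃A₄ (i.e., orthogonal to A₃ − A₂ and A₄ − A₂) and P − P₂ is orthogonal to the plane of A₁A₃A₄ (i.e., orthogonal to A₃ − A₁ and A₄ − A₁). Then d(P₂,A₃)² + d(P₁,A₄)² = d(P₂,A₄)² + d(P₁,A₃)². -/
open scoped RealInnerProductSpace

/-- If the normals to faces `A₂A₃A₄` and `A₁A₃A₄` of a tetrahedron at points `P₁`, `P₂`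
(lying in the planes of those faces) have a common point, then
`d(P₂,A₃)² + d(P₁,A₄)² = d(P₂,A₄)² + d(P₁,A₃)²`. -/
theorem concurrent_face_normals_distance_relation
    (A1 A2 A3 A4 P1 P2 : EuclideanSpace ℝ (Fin 3))
    (hind : AffineIndependent ℝ ![A1, A2, A3, A4])
    (hP1mem : P1 ∈ affineSpan ℝ ({A2, A3, A4} : Set (EuclideanSpace ℝ (Fin 3))))
    (hP2mem : P2 ∈ affineSpan ℝ ({A1, A3, A4} : Set (EuclideanSpace ℝ (Fin 3))))
    (hconc : ∃ P : EuclideanSpace ℝ (Fin 3),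
      (⟪P - P1, A3 - A2⟫ = 0 ∧ ⟪P - P1, A4 - A2⟫ = 0) ∧
      (⟪P - P2, A3 - A1⟫ = 0 ∧ ⟪P - P2, A4 - A1⟫ = 0)) :
    dist P2 A3 ^ 2 + dist P1 A4 ^ 2 = dist P2 A4 ^ 2 + dist P1 A3 ^ 2 := by
  obtain ⟨P, ⟨h1, h2⟩, h3, h4⟩ := hconc
  simp only [EuclideanSpace.dist_eq, Real.dist_eq, sq_abs]
  rw [Real.sq_sqrt (by positivity), Real.sq_sqrt (by positivity),
    Real.sq_sqrt (by positivity), Real.sq_sqrt (by positivity)]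
  simp only [PiLp.inner_apply, Fin.sum_univ_three, PiLp.sub_apply, RCLike.inner_apply,
    conj_trivial] at *
  linarith
end

section
/- Let F : (0,∞)³ → (0,∞) be continuous, homogeneous of some degree d ∈ ℝ (F(tx,ty,tz) = t^d·F(x,y,z) for all t, x, y, z > 0), and symmetric in its last two arguments (F(x,y,z) = F(x,z,y) for all x, y, z > 0). Suppose F satisfies the hyperbolic condition: for all positive reals a₁, a₂, a₃, b₁, b₂, b₃, F(b₂,a₁,b₃)·F(b₃,b₁,a₂)·F(b₁,a₃,b₂) = F(b₃,b₂,a₁)·F(b₁,a₂,b₃)·F(b₂,b₁,a₃). Then there exists r ∈ ℝ such that y^r·F(x,y,z) = x^r·F(y,z,x) for all x, y, z > 0; that is, F(x,y,z) : F(y,z,x) : F(z,x,y) = x^r : y^r : z^r, so the associated triangle center is a power point. -/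
/-- The power points are the only triangle centers whose cevians form a hyperbolic group
in every tetrahedron: if a continuous, homogeneous center function `F` (positive on positive
triples and symmetric in its last two arguments) satisfies the hyperbolic condition
`F(b₂,a₁,b₃)F(b₃,b₁,a₂)F(b₁,a₃,b₂) = F(b₃,b₂,a₁)F(b₁,a₂,b₃)F(b₂,b₁,a₃)` for all positive
edge lengths, then there is an `r` with
`F(x,y,z) : F(y,z,x) : F(z,x,y) = x^r : y^r : z^r`, i.e. the center is a power point. -/
theorem hyperbolic_center_function_is_power_point
    (F : ℝ → ℝ → ℝ → ℝ) (d : ℝ)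
    (hpos : ∀ x y z : ℝ, 0 < x → 0 < y → 0 < z → 0 < F x y z)
    (hcont : ContinuousOn (fun p : ℝ × ℝ × ℝ => F p.1 p.2.1 p.2.2)
      {p : ℝ × ℝ × ℝ | 0 < p.1 ∧ 0 < p.2.1 ∧ 0 < p.2.2})
    (hhom : ∀ t x y z : ℝ, 0 < t → 0 < x → 0 < y → 0 < z →
      F (t * x) (t * y) (t * z) = t ^ d * F x y z)
    (hsym : ∀ x y z : ℝ, 0 < x → 0 < y → 0 < z → F x y z = F x z y)
    (hhyp : ∀ a1 a2 a3 b1 b2 b3 : ℝ,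
      0 < a1 → 0 < a2 → 0 < a3 → 0 < b1 → 0 < b2 → 0 < b3 →
      F b2 a1 b3 * F b3 b1 a2 * F b1 a3 b2 = F b3 b2 a1 * F b1 a2 b3 * F b2 b1 a3) :
    ∃ r : ℝ, ∀ x y z : ℝ, 0 < x → 0 < y → 0 < z →
      y ^ r * F x y z = x ^ r * F y z x := by
  have hind : ∀ x y a c : ℝ, 0 < x → 0 < y → 0 < a → 0 < c →
      F x y a / F y x a = F x y c / F y x c := by
    intro x y a c hx hy ha hc
    have h1 := hhyp a 1 1 1 x y ha one_pos one_pos one_pos hx hy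
    have h2 := hhyp c 1 1 1 x y hc one_pos one_pos one_pos hx hy
    rw [hsym x a y hx ha hy] at h1
    rw [hsym x c y hx hc hy] at h2
    have p1 := hpos y x a hy hx ha
    have p2 := hpos y x c hy hx hc
    have p3 := hpos y 1 1 hy one_pos one_pos
    have p4 := hpos 1 1 x one_pos one_pos hx
    have p5 := hpos 1 1 y one_pos one_pos hy
    have p6 := hpos x 1 1 hx one_pos one_pos
    have e1 : F x y a / F y x a = (F 1 1 y * F x 1 1) / (F y 1 1 * F 1 1 x) := by
      rw [div_eq_div_iff (by positivity) (by positivity)]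
      linarith
    have e2 : F x y c / F y x c = (F 1 1 y * F x 1 1) / (F y 1 1 * F 1 1 x) := by
      rw [div_eq_div_iff (by positivity) (by positivity)]
      linarith
    rw [e1, e2]
  obtain ⟨g, hg⟩ : ∃ g : ℝ → ℝ, g = fun t => F t 1 1 / F 1 t 1 := ⟨_, rfl⟩
  have hgpos : ∀ t, 0 < t → 0 < g t := by
    intro t ht
    rw [hg]
    exact div_pos (hpos _ _ _ ht one_pos one_pos) (hpos _ _ _ one_pos ht one_pos)
  have hR : ∀ x y a : ℝ, 0 < x → 0 < y → 0 < a → F x y a / F y x a = g (x / y) := by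
    intro x y a hx hy ha
    rw [hind x y a y hx hy ha hy, hg]
    have h1 := hhom y (x / y) 1 1 hy (div_pos hx hy) one_pos one_pos
    have h2 := hhom y 1 (x / y) 1 hy one_pos (div_pos hx hy) one_pos
    rw [mul_div_cancel₀ x hy.ne', mul_one] at h1 h2
    rw [h1, h2]
    exact mul_div_mul_left _ _ (Real.rpow_pos_of_pos hy d).ne'
  have hmul : ∀ s t : ℝ, 0 < s → 0 < t → g (s * t) = g s * g t := by
    intro s t hs ht
    have hst := mul_pos hs ht
    have h1 := hhyp 1 1 1 1 (s * t) t one_pos one_pos one_pos one_pos hst ht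
    have h2 := hR (s * t) t 1 hst ht one_pos
    rw [mul_div_cancel_right₀ s ht.ne'] at h2
    rw [hsym _ 1 t hst one_pos ht, hsym 1 1 (s * t) one_pos one_pos hst,
      hsym 1 1 t one_pos one_pos ht] at h1
    have p1 := hpos t (s * t) 1 ht hst one_pos
    have p2 := hpos 1 t 1 one_pos ht one_pos
    have p3 := hpos 1 (s * t) 1 one_pos hst one_pos
    rw [← h2, hg]
    simp only
    rw [div_mul_div_comm, div_eq_div_iff (by positivity) (by positivity)]
    linarith
  have hgc : Continuous (fun u : ℝ => Real.log (g (Real.exp u))) := by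
    have c1 : Continuous (fun u : ℝ => F (Real.exp u) 1 1) :=
      hcont.comp_continuous (f := fun u : ℝ => ((Real.exp u, 1, 1) : ℝ × ℝ × ℝ))
        (by fun_prop) (fun u => ⟨Real.exp_pos u, one_pos, one_pos⟩)
    have c2 : Continuous (fun u : ℝ => F 1 (Real.exp u) 1) :=
      hcont.comp_continuous (f := fun u : ℝ => ((1, Real.exp u, 1) : ℝ × ℝ × ℝ))
        (by fun_prop) (fun u => ⟨one_pos, Real.exp_pos u, one_pos⟩)
    refine Continuous.log ?_ (fun u => (hgpos _ (Real.exp_pos u)).ne')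
    rw [hg]
    exact c1.div c2 (fun u => (hpos _ _ _ one_pos (Real.exp_pos u) one_pos).ne')
  let h : ℝ →+ ℝ := AddMonoidHom.mk' (fun u : ℝ => Real.log (g (Real.exp u))) (by
    intro u v
    rw [Real.exp_add, hmul _ _ (Real.exp_pos u) (Real.exp_pos v),
      Real.log_mul (hgpos _ (Real.exp_pos u)).ne' (hgpos _ (Real.exp_pos v)).ne'])
  have hlin : ∀ u : ℝ, Real.log (g (Real.exp u)) = u * h 1 := by
    intro u
    have := map_real_smul h hgc u 1
    rw [smul_eq_mul, mul_one, smul_eq_mul] at this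
    exact this
  refine ⟨h 1, fun x y z hx hy hz => ?_⟩
  have hxy := div_pos hx hy
  have hgr : g (x / y) = (x / y) ^ (h 1) := by
    have := hlin (Real.log (x / y))
    rw [Real.exp_log hxy] at this
    rw [Real.rpow_def_of_pos hxy, ← this, Real.exp_log (hgpos _ hxy)]
  have hfin := hR x y z hx hy hz
  rw [hgr, Real.div_rpow hx.le hy.le, div_eq_div_iff (hpos _ _ _ hy hx hz).ne'
    (Real.rpow_pos_of_pos hy _).ne'] at hfin
  rw [hsym y z x hy hz hx]
  linarith
end
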